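/- Let p : ℝ → ℝ be continuously differentiable, m, ω ∈ ℝ, and let Ω ⊆ ℝ² be a domain. Suppose W = W₁ + W₂·k (W₁, W₂ : Ω → ℂ twice continuously differentiable) is a solution of the bicomplex Vekua equation ∂̄W = conj(b·W) in Ω, where b(x,y) = (p(x) + m) − iω·k and conj denotes the bicomplex conjugation. Then W₁ = Sc(W) solves the stationary Schrödinger equation −ΔW₁ + ν₁·W₁ = 0 in Ω with ν₁(x) = p′(x) + (p(x) + m)² − ω², and W₂ = Vec(W) solves −ΔW₂ + ν₂·W₂ = 0 in Ω with ν₂(x) = −p′(x) + (p(x) + m)² − ω². -/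

import Mathlib

open MeasureTheory

/-- Bicomplex numbers: `q = q0 + q1·k` with `q0, q1 : ℂ`, `k² = -1`, `ik = ki`. -/
structure Bicomplex : Type where
  re : ℂ
  im : ℂ

namespace Bicomplex

instance : Zero Bicomplex := ⟨⟨0, 0⟩⟩
instance : One Bicomplex := ⟨⟨1, 0⟩⟩
instance : Add Bicomplex := ⟨fun p q => ⟨p.re + q.re, p.im + q.im⟩⟩
instance : Neg Bicomplex := ⟨fun p => ⟨-p.re, -p.im⟩⟩
instance : Sub Bicomplex := ⟨fun p q => ⟨p.re - q.re, p.im - q.im⟩⟩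
instance : Mul Bicomplex := ⟨fun p q => ⟨p.re * q.re - p.im * q.im, p.re * q.im + p.im * q.re⟩⟩

/-- bicomplex conjugation `q0 + q1·k ↦ q0 - q1·k` -/
def conj (q : Bicomplex) : Bicomplex := ⟨q.re, -q.im⟩

/-- the second imaginary unit `k` -/
def k : Bicomplex := ⟨0, 1⟩

/-- embedding of ℂ into the bicomplex numbers -/
def ofC (z : ℂ) : Bicomplex := ⟨z, 0⟩

/-- bicomplex inverse: `q⁻¹ = q̄/(q0² + q1²)` (junk value if not invertible) -/
noncomputable def inv (q : Bicomplex) : Bicomplex :=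
  ⟨q.re / (q.re ^ 2 + q.im ^ 2), -q.im / (q.re ^ 2 + q.im ^ 2)⟩

/-- the set 𝔖 of bicomplex zero divisors: nonzero `q` with `q·q̄ = q0² + q1² = 0` -/
def zeroDivSet : Set Bicomplex := {q | q ≠ 0 ∧ q.re ^ 2 + q.im ^ 2 = 0}

end Bicomplex

/-- ∂/∂x of a complex-valued function on ℝ² -/
noncomputable def pdx (f : ℝ × ℝ → ℂ) (p : ℝ × ℝ) : ℂ := deriv (fun t => f (t, p.2)) p.1
/-- ∂/∂y of a complex-valued function on ℝ² -/
noncomputable def pdy (f : ℝ × ℝ → ℂ) (p : ℝ × ℝ) : ℂ := deriv (fun t => f (p.1, t)) p.2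
/-- Laplacian Δ = ∂²/∂x² + ∂²/∂y² of a complex-valued function on ℝ² -/
noncomputable def lap (f : ℝ × ℝ → ℂ) (p : ℝ × ℝ) : ℂ := pdx (pdx f) p + pdy (pdy f) p

/-- ∂/∂x of a bicomplex-valued function on ℝ² (componentwise) -/
noncomputable def bpdx (F : ℝ × ℝ → Bicomplex) (p : ℝ × ℝ) : Bicomplex :=
  ⟨pdx (fun q => (F q).re) p, pdx (fun q => (F q).im) p⟩
/-- ∂/∂y of a bicomplex-valued function on ℝ² (componentwise) -/
noncomputable def bpdy (F : ℝ × ℝ → Bicomplex) (p : ℝ × ℝ) : Bicomplex :=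
  ⟨pdy (fun q => (F q).re) p, pdy (fun q => (F q).im) p⟩

/-- `∂̄ = ∂/∂x + k·∂/∂y` -/
noncomputable def dbar (F : ℝ × ℝ → Bicomplex) (p : ℝ × ℝ) : Bicomplex :=
  bpdx F p + Bicomplex.k * bpdy F p

/-- `∂ = ∂/∂x − k·∂/∂y` -/
noncomputable def dz (F : ℝ × ℝ → Bicomplex) (p : ℝ × ℝ) : Bicomplex :=
  bpdx F p - Bicomplex.k * bpdy F p

/-- continuity of a bicomplex-valued function (componentwise) -/
def BContinuousOn (F : ℝ × ℝ → Bicomplex) (Ω : Set (ℝ × ℝ)) : Prop :=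
  ContinuousOn (fun p => (F p).re) Ω ∧ ContinuousOn (fun p => (F p).im) Ω

/-- `C^n` smoothness of a bicomplex-valued function (componentwise) -/
def BContDiffOn (n : ℕ∞) (F : ℝ × ℝ → Bicomplex) (Ω : Set (ℝ × ℝ)) : Prop :=
  ContDiffOn ℝ n (fun p => (F p).re) Ω ∧ ContDiffOn ℝ n (fun p => (F p).im) Ω

/-- characteristic coefficient `a_(F,G)` -/
noncomputable def aCoef (F G : ℝ × ℝ → Bicomplex) (z : ℝ × ℝ) : Bicomplex :=
  -((Bicomplex.conj (F z) * dbar G z - dbar F z * Bicomplex.conj (G z)) *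
    Bicomplex.inv (F z * Bicomplex.conj (G z) - Bicomplex.conj (F z) * G z))
/-- characteristic coefficient `b_(F,G)` -/
noncomputable def bCoef (F G : ℝ × ℝ → Bicomplex) (z : ℝ × ℝ) : Bicomplex :=
  (F z * dbar G z - dbar F z * G z) *
    Bicomplex.inv (F z * Bicomplex.conj (G z) - Bicomplex.conj (F z) * G z)
/-- characteristic coefficient `A_(F,G)` -/
noncomputable def ACoef (F G : ℝ × ℝ → Bicomplex) (z : ℝ × ℝ) : Bicomplex :=
  -((Bicomplex.conj (F z) * dz G z - dz F z * Bicomplex.conj (G z)) *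
    Bicomplex.inv (F z * Bicomplex.conj (G z) - Bicomplex.conj (F z) * G z))
/-- characteristic coefficient `B_(F,G)` -/
noncomputable def BCoef (F G : ℝ × ℝ → Bicomplex) (z : ℝ × ℝ) : Bicomplex :=
  (F z * dz G z - dz F z * G z) *
    Bicomplex.inv (F z * Bicomplex.conj (G z) - Bicomplex.conj (F z) * G z)

/-- `(F,G)` is a generating pair on `Ω` -/
def IsGeneratingPair (F G : ℝ × ℝ → Bicomplex) (Ω : Set (ℝ × ℝ)) : Prop :=
  BContDiffOn 1 F Ω ∧ BContDiffOn 1 G Ω ∧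
    ∀ z ∈ Ω, (Bicomplex.conj (F z) * G z).im ≠ 0

open scoped Topology

theorem hasDerivAt_pdx {f : ℝ × ℝ → ℂ} {z : ℝ × ℝ} (hf : DifferentiableAt ℝ f z) :
    HasDerivAt (fun t => f (t, z.2)) (pdx f z) z.1 := by
  have h : DifferentiableAt ℝ (fun t : ℝ => f (t, z.2)) z.1 :=
    DifferentiableAt.comp z.1 (g := f) (f := fun t : ℝ => (t, z.2)) hf (by fun_prop)
  exact h.hasDerivAt

theorem hasDerivAt_pdy {f : ℝ × ℝ → ℂ} {z : ℝ × ℝ} (hf : DifferentiableAt ℝ f z) :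
    HasDerivAt (fun t => f (z.1, t)) (pdy f z) z.2 := by
  have h : DifferentiableAt ℝ (fun t : ℝ => f (z.1, t)) z.2 :=
    DifferentiableAt.comp z.2 (g := f) (f := fun t : ℝ => (z.1, t)) hf (by fun_prop)
  exact h.hasDerivAt

theorem pdx_eq_fderiv {f : ℝ × ℝ → ℂ} {z : ℝ × ℝ} (hf : DifferentiableAt ℝ f z) :
    pdx f z = fderiv ℝ f z (1, 0) :=
  (hf.hasFDerivAt.comp_hasDerivAt z.1
    ((hasDerivAt_id z.1).prodMk (hasDerivAt_const z.1 z.2))).deriv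

theorem pdy_eq_fderiv {f : ℝ × ℝ → ℂ} {z : ℝ × ℝ} (hf : DifferentiableAt ℝ f z) :
    pdy f z = fderiv ℝ f z (0, 1) :=
  (hf.hasFDerivAt.comp_hasDerivAt z.2
    ((hasDerivAt_const z.2 z.1).prodMk (hasDerivAt_id z.2))).deriv

theorem pdx_congr {f g : ℝ × ℝ → ℂ} {z : ℝ × ℝ} (h : f =ᶠ[𝓝 z] g) : pdx f z = pdx g z := by
  have hc : Filter.Tendsto (fun t : ℝ => (t, z.2)) (𝓝 z.1) (𝓝 z) :=
    Continuous.tendsto (f := fun t : ℝ => (t, z.2)) (by fun_prop) z.1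
  exact Filter.EventuallyEq.deriv_eq (hc.eventually h)

theorem pdy_congr {f g : ℝ × ℝ → ℂ} {z : ℝ × ℝ} (h : f =ᶠ[𝓝 z] g) : pdy f z = pdy g z := by
  have hc : Filter.Tendsto (fun t : ℝ => (z.1, t)) (𝓝 z.2) (𝓝 z) :=
    Continuous.tendsto (f := fun t : ℝ => (z.1, t)) (by fun_prop) z.2
  exact Filter.EventuallyEq.deriv_eq (hc.eventually h)

theorem ContDiffAt.eventually_differentiableAt {f : ℝ × ℝ → ℂ} {z : ℝ × ℝ}
    (hf : ContDiffAt ℝ 2 f z) : ∀ᶠ q in 𝓝 z, DifferentiableAt ℝ f q :=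
  (hf.eventually (by simp)).mono fun _ hq => hq.differentiableAt (by simp)

theorem pdx_eventuallyEq_fderiv {f : ℝ × ℝ → ℂ} {z : ℝ × ℝ} (hf : ContDiffAt ℝ 2 f z) :
    pdx f =ᶠ[𝓝 z] fun q => fderiv ℝ f q (1, 0) :=
  hf.eventually_differentiableAt.mono fun _ hq => pdx_eq_fderiv hq

theorem pdy_eventuallyEq_fderiv {f : ℝ × ℝ → ℂ} {z : ℝ × ℝ} (hf : ContDiffAt ℝ 2 f z) :
    pdy f =ᶠ[𝓝 z] fun q => fderiv ℝ f q (0, 1) :=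
  hf.eventually_differentiableAt.mono fun _ hq => pdy_eq_fderiv hq

theorem ContDiffAt.differentiableAt_fderiv {f : ℝ × ℝ → ℂ} {z : ℝ × ℝ}
    (hf : ContDiffAt ℝ 2 f z) : DifferentiableAt ℝ (fderiv ℝ f) z :=
  (hf.fderiv_right (m := 1) (by norm_num)).differentiableAt (by simp)

theorem differentiableAt_pdx {f : ℝ × ℝ → ℂ} {z : ℝ × ℝ} (hf : ContDiffAt ℝ 2 f z) :
    DifferentiableAt ℝ (pdx f) z :=
  (hf.differentiableAt_fderiv.clm_apply (differentiableAt_const _)).congr_of_eventuallyEq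
    (pdx_eventuallyEq_fderiv hf)

theorem differentiableAt_pdy {f : ℝ × ℝ → ℂ} {z : ℝ × ℝ} (hf : ContDiffAt ℝ 2 f z) :
    DifferentiableAt ℝ (pdy f) z :=
  (hf.differentiableAt_fderiv.clm_apply (differentiableAt_const _)).congr_of_eventuallyEq
    (pdy_eventuallyEq_fderiv hf)

/-- Mixed second partial derivatives of a `C²` function commute. -/
theorem pdx_pdy_comm {f : ℝ × ℝ → ℂ} {z : ℝ × ℝ} (hf : ContDiffAt ℝ 2 f z) :
    pdx (pdy f) z = pdy (pdx f) z := by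
  have hd := hf.differentiableAt_fderiv
  have hsymm : IsSymmSndFDerivAt ℝ f z := hf.isSymmSndFDerivAt (by simp)
  rw [pdx_eq_fderiv (differentiableAt_pdy hf), pdy_eq_fderiv (differentiableAt_pdx hf),
    (pdy_eventuallyEq_fderiv hf).fderiv_eq, (pdx_eventuallyEq_fderiv hf).fderiv_eq,
    fderiv_clm_apply hd (differentiableAt_const _), fderiv_clm_apply hd (differentiableAt_const _)]
  simpa using hsymm.eq (1, 0) (0, 1)

/-- for the Vekua equation `∂̄W = conj(b·W)` with
`b = (p(x)+m) − iω·k` coming from the Dirac equation with scalar potential `p(x)`,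
the scalar part solves `−ΔW₁ + ν₁W₁ = 0` with `ν₁ = p′ + (p+m)² − ω²` and the vector
part solves `−ΔW₂ + ν₂W₂ = 0` with `ν₂ = −p′ + (p+m)² − ω²`. -/
theorem Dirac_scalar_potential_Schroedinger
    (Ω : Set (ℝ × ℝ)) (hΩo : IsOpen Ω) (hΩc : IsConnected Ω)
    (p : ℝ → ℝ) (hp : ContDiff ℝ 1 p) (m ω : ℝ)
    (W₁ W₂ : ℝ × ℝ → ℂ)
    (hW₁ : ContDiffOn ℝ 2 W₁ Ω) (hW₂ : ContDiffOn ℝ 2 W₂ Ω)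
    (hVek : ∀ z ∈ Ω,
      dbar (fun q => (⟨W₁ q, W₂ q⟩ : Bicomplex)) z =
        Bicomplex.conj
          ((⟨((p z.1 + m : ℝ) : ℂ), -(Complex.I * (ω : ℂ))⟩ : Bicomplex) *
            ⟨W₁ z, W₂ z⟩)) :
    (∀ z ∈ Ω,
      -lap W₁ z +
        (((deriv p z.1 : ℝ) : ℂ) + ((p z.1 + m : ℝ) : ℂ) ^ 2 - ((ω : ℝ) : ℂ) ^ 2) *
          W₁ z = 0) ∧
    (∀ z ∈ Ω,
      -lap W₂ z +
        (-((deriv p z.1 : ℝ) : ℂ) + ((p z.1 + m : ℝ) : ℂ) ^ 2 - ((ω : ℝ) : ℂ) ^ 2) *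
          W₂ z = 0) := by
  have hsys : ∀ z ∈ Ω,
      pdx W₁ z - pdy W₂ z = (p z.1 + m) * W₁ z + Complex.I * ω * W₂ z ∧
        pdx W₂ z + pdy W₁ z = -((p z.1 + m) * W₂ z) + Complex.I * ω * W₁ z := by
    intro z hz
    have h := hVek z hz
    have h1 := congrArg Bicomplex.re h
    have h2 := congrArg Bicomplex.im h
    change pdx W₁ z + (0 * pdy W₁ z - 1 * pdy W₂ z) =
      ((p z.1 + m : ℝ) : ℂ) * W₁ z - -(Complex.I * ω) * W₂ z at h1
    change pdx W₂ z + (0 * pdy W₂ z + 1 * pdy W₁ z) =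
      -(((p z.1 + m : ℝ) : ℂ) * W₂ z + -(Complex.I * ω) * W₁ z) at h2
    push_cast at h1 h2
    exact ⟨by linear_combination h1, by linear_combination h2⟩
  have hpd (x : ℝ) : HasDerivAt (fun t : ℝ => (p t : ℂ) + m) (deriv p x : ℝ) x :=
    ((hp.differentiable (by simp) x).hasDerivAt.ofReal_comp).add_const _
  refine ⟨fun z hz => ?_, fun z hz => ?_⟩
  all_goals
    have hnhds : Ω ∈ 𝓝 z := hΩo.mem_nhds hz
    have c₁ := hW₁.contDiffAt hnhds
    have c₂ := hW₂.contDiffAt hnhds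
    have d₁ := c₁.differentiableAt (by simp)
    have d₂ := c₂.differentiableAt (by simp)
    have e₁ := (hsys z hz).1
    have e₂ := (hsys z hz).2
    have hI := Complex.I_sq
  · have hxx : pdx (pdx W₁) z = _ := (pdx_congr (g := fun q =>
        pdy W₂ q + (p q.1 + m) * W₁ q + Complex.I * ω * W₂ q)
      (Filter.eventually_of_mem hnhds fun q hq => by
        linear_combination (hsys q hq).1)).trans
      (((hasDerivAt_pdx (differentiableAt_pdy c₂)).add
        ((hpd z.1).mul (hasDerivAt_pdx d₁))).add
        ((hasDerivAt_pdx d₂).const_mul (Complex.I * (ω : ℂ)))).deriv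
    have hyy : pdy (pdy W₁) z = _ := (pdy_congr (g := fun q =>
        -pdx W₂ q - (p q.1 + m) * W₂ q + Complex.I * ω * W₁ q)
      (Filter.eventually_of_mem hnhds fun q hq => by
        linear_combination (hsys q hq).2)).trans
      (((hasDerivAt_pdy (differentiableAt_pdx c₂)).neg.sub
        ((hasDerivAt_pdy d₂).const_mul ((p z.1 : ℂ) + m))).add
        ((hasDerivAt_pdy d₁).const_mul (Complex.I * (ω : ℂ)))).deriv
    rw [lap, hxx, hyy, pdx_pdy_comm c₂]
    push_cast
    linear_combination (-(p z.1 : ℂ) - m) * e₁ - Complex.I * ω * e₂ - ω ^ 2 * W₁ z * hI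
  · have hxx : pdx (pdx W₂) z = _ := (pdx_congr (g := fun q =>
        -pdy W₁ q - (p q.1 + m) * W₂ q + Complex.I * ω * W₁ q)
      (Filter.eventually_of_mem hnhds fun q hq => by
        linear_combination (hsys q hq).2)).trans
      (((hasDerivAt_pdx (differentiableAt_pdy c₁)).neg.sub
        ((hpd z.1).mul (hasDerivAt_pdx d₂))).add
        ((hasDerivAt_pdx d₁).const_mul (Complex.I * (ω : ℂ)))).deriv
    have hyy : pdy (pdy W₂) z = _ := (pdy_congr (g := fun q =>
        pdx W₁ q - (p q.1 + m) * W₁ q - Complex.I * ω * W₂ q)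
      (Filter.eventually_of_mem hnhds fun q hq => by
        linear_combination -(hsys q hq).1)).trans
      (((hasDerivAt_pdy (differentiableAt_pdx c₁)).sub
        ((hasDerivAt_pdy d₁).const_mul ((p z.1 : ℂ) + m))).sub
        ((hasDerivAt_pdy d₂).const_mul (Complex.I * (ω : ℂ)))).deriv
    rw [lap, hxx, hyy, pdx_pdy_comm c₁]
    push_cast
    linear_combination ((p z.1 : ℂ) + m) * e₂ - Complex.I * ω * e₁ - ω ^ 2 * W₂ z * hI
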